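/- Assume the base graph G is connected (and bipartite with at least one edge). Then the diameter of G_n satisfies Diam(G_n) ≤ 2n + Diam(G) − 2; since |V(G_n)| = Nⁿ, this gives Diam(G_n) = (2/log N)·log(|V(G_n)|) + O(1) as n → ∞. -/

import Mathlib

noncomputable section
attribute [local instance] Classical.propDecidable

namespace HierGraph

open Finset MeasureTheory ProbabilityTheory

variable {N : ℕ}

/-- The degree of a vertex in a finite simple graph. -/
def degH {α : Type*} [Fintype α] (H : SimpleGraph α) (v : α) : ℕ :=
  (univ.filter fun w => H.Adj v w).card

/-- The length `|x ∧ y|` of the longest common prefix of two words. -/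
def prefixLen {n : ℕ} (x y : Fin n → Fin N) : ℕ :=
  (univ.filter fun i : Fin n => ∀ j : Fin n, j ≤ i → x j = y j).card

/-- The postfix of `x` starting at position `k` has constant type
(`t = true` ↔ all its letters lie in `V1`). -/
def postfixType (V1 : Finset (Fin N)) {n : ℕ} (k : ℕ) (x : Fin n → Fin N) (t : Bool) : Prop :=
  ∀ i : Fin n, k ≤ i.val → (x i ∈ V1 ↔ t = true)

/-- The edge relation of the graph `Gₙ` (loops included): `x = y`, or the two postfixes
after the common prefix have types `{1,2}` and corresponding letters are adjacent in `G`. -/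
def EdgeRel (G : SimpleGraph (Fin N)) (V1 : Finset (Fin N)) {n : ℕ} (x y : Fin n → Fin N) :
    Prop :=
  x = y ∨
    ((∃ t : Bool, postfixType V1 (prefixLen x y) x t ∧ postfixType V1 (prefixLen x y) y (!t)) ∧
      ∀ i : Fin n, prefixLen x y ≤ i.val → G.Adj (x i) (y i))

/-- The degree of a vertex of `Gₙ`, the loop counting `2`. -/
def degGn (G : SimpleGraph (Fin N)) (V1 : Finset (Fin N)) {n : ℕ} (x : Fin n → Fin N) : ℕ :=
  2 + (univ.filter fun y : Fin n → Fin N => y ≠ x ∧ EdgeRel G V1 x y).card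

/-- `ℓ(x)`: the length of the longest suffix of `x` of constant (nonzero) type. -/
def ell (V1 : Finset (Fin N)) {n : ℕ} (x : Fin n → Fin N) : ℕ :=
  ((Finset.Icc 1 n).filter fun i =>
    (∀ j : Fin n, n - i ≤ j.val → x j ∈ V1) ∨ ∀ j : Fin n, n - i ≤ j.val → x j ∉ V1).sup id

/-- `S(x) = Σ_{r=0}^{ℓ(x)-1} Π_{j=1}^{r} deg(x_{n-j})`. -/
def Sx (G : SimpleGraph (Fin N)) (V1 : Finset (Fin N)) {n : ℕ} (hn : 0 < n)
    (x : Fin n → Fin N) : ℕ :=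
  ∑ r ∈ Finset.range (ell V1 x), ∏ j ∈ Finset.Icc 1 r, degH G (x ⟨n - 1 - j, by omega⟩)

/-- The simple graph `Gₙ` (loops removed). -/
def GnSimple (G : SimpleGraph (Fin N)) (V1 : Finset (Fin N)) (n : ℕ) :
    SimpleGraph (Fin n → Fin N) :=
  SimpleGraph.fromRel (EdgeRel G V1)

/-- The diameter of a finite graph: the maximal graph distance. -/
def fdiam {α : Type*} [Fintype α] (H : SimpleGraph α) : ℕ :=
  univ.sup fun p : α × α => H.dist p.1 p.2

/-- The number of maximal constant-type blocks of the postfix of `x` starting at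
position `k` (`k < n`). -/
def blockCount (V1 : Finset (Fin N)) {n : ℕ} (k : ℕ) (x : Fin n → Fin N) : ℕ :=
  1 + (univ.filter fun i : Fin n =>
        k ≤ i.val ∧ ∃ h : i.val + 1 < n, ¬((x i ∈ V1) ↔ x ⟨i.val + 1, h⟩ ∈ V1)).card

/-- The left endpoint of the `N`-adic interval `I_x`. -/
def Ipt {n : ℕ} (x : Fin n → Fin N) : ℝ := ∑ r : Fin n, (x r : ℝ) / (N : ℝ) ^ (r.val + 1)

/-- The `N`-adic interval `I_x ⊆ [0,1]`. -/
def Iset {n : ℕ} (x : Fin n → Fin N) : Set ℝ := Set.Icc (Ipt x) (Ipt x + 1 / (N : ℝ) ^ n)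

/-- The level-`n` square `Q_{(x,y)} = I_x × I_y`. -/
def Qset {n : ℕ} (x y : Fin n → Fin N) : Set (ℝ × ℝ) := Iset x ×ˢ Iset y

/-- `Λₙ`: the embedded adjacency matrix of `Gₙ` in the unit square. -/
def Lam (G : SimpleGraph (Fin N)) (V1 : Finset (Fin N)) (n : ℕ) : Set (ℝ × ℝ) :=
  ⋃ (p : (Fin n → Fin N) × (Fin n → Fin N)) (_ : EdgeRel G V1 p.1 p.2), Qset p.1 p.2

/-- `Λ = ⋂_{n ≥ 1} Λₙ`. -/
def LamInf (G : SimpleGraph (Fin N)) (V1 : Finset (Fin N)) : Set (ℝ × ℝ) :=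
  ⋂ (n : ℕ) (_ : 1 ≤ n), Lam G V1 n

/-- The homothety `f_v(a,b) = ((a,b) + v)/N` for `v ∈ Σ₁ × Σ₁`. -/
def fmap (N : ℕ) (v : Fin N × Fin N) : ℝ × ℝ → ℝ × ℝ :=
  fun p => ((p.1 + (v.1 : ℝ)) / N, (p.2 + (v.2 : ℝ)) / N)

/-- `f_v = f_{v₁} ∘ ⋯ ∘ f_{vₙ}` for a word `v` over `Σ₁ × Σ₁` (identity for the empty word). -/
def fpath {n : ℕ} (v : Fin n → Fin N × Fin N) : ℝ × ℝ → ℝ × ℝ :=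
  (List.ofFn fun i => fmap N (v i)).foldr (· ∘ ·) id

/-- The unit square `[0,1]²`. -/
def unitSq : Set (ℝ × ℝ) := Set.Icc (0 : ℝ) 1 ×ˢ Set.Icc (0 : ℝ) 1

/-- The diagonal `{(t,t) : t ∈ [0,1]}`. -/
def DiagSet : Set (ℝ × ℝ) := (fun t : ℝ => (t, t)) '' Set.Icc (0 : ℝ) 1

/-- `V_dd`, the diagonal vertices of the directed graph `𝒢`. -/
def Vdd (v : Fin N × Fin N) : Prop := v.1 = v.2

/-- `V₁₂`, vertices of `𝒢` coming from edges of `G` directed from `V₁` to `V₂`. -/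
def V12 (G : SimpleGraph (Fin N)) (V1 : Finset (Fin N)) (v : Fin N × Fin N) : Prop :=
  v.1 ∈ V1 ∧ v.2 ∉ V1 ∧ G.Adj v.1 v.2

/-- `V₂₁`, vertices of `𝒢` coming from edges of `G` directed from `V₂` to `V₁`. -/
def V21 (G : SimpleGraph (Fin N)) (V1 : Finset (Fin N)) (v : Fin N × Fin N) : Prop :=
  v.1 ∉ V1 ∧ v.2 ∈ V1 ∧ G.Adj v.1 v.2

/-- Vertices of the directed graph `𝒢`. -/
def calGVert (G : SimpleGraph (Fin N)) (V1 : Finset (Fin N)) (v : Fin N × Fin N) : Prop :=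
  Vdd v ∨ V12 G V1 v ∨ V21 G V1 v

/-- Directed edges of `𝒢`: all pairs (loops included) within each of `V_dd`, `V₁₂`, `V₂₁`,
plus one edge from each vertex of `V_dd` to each vertex of `V₁₂ ∪ V₂₁`. -/
def calGEdge (G : SimpleGraph (Fin N)) (V1 : Finset (Fin N)) (u v : Fin N × Fin N) : Prop :=
  (Vdd u ∧ Vdd v) ∨ (V12 G V1 u ∧ V12 G V1 v) ∨ (V21 G V1 u ∧ V21 G V1 v) ∨
    (Vdd u ∧ (V12 G V1 v ∨ V21 G V1 v))

/-- `v ∈ 𝒫ₙ`: `v` is a directed path of length `n` in `𝒢`. -/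
def IsPathCalG (G : SimpleGraph (Fin N)) (V1 : Finset (Fin N)) {n : ℕ}
    (v : Fin n → Fin N × Fin N) : Prop :=
  (∀ i, calGVert G V1 (v i)) ∧
    ∀ i j : Fin n, (j : ℕ) = (i : ℕ) + 1 → calGEdge G V1 (v i) (v j)

/-- Non-loop edges of `Gₙ`, i.e. edges of `G'ₙ`. -/
def GnEdge' (G : SimpleGraph (Fin N)) (V1 : Finset (Fin N)) {n : ℕ} (x y : Fin n → Fin N) :
    Prop :=
  x ≠ y ∧ EdgeRel G V1 x y

/-- The extra edges `RE(Ĝₙ)`: the two words agree except in the last letter, and the last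
letters form an extra edge (an edge of `R`). -/
def REn (R : SimpleGraph (Fin N)) {n : ℕ} (x y : Fin n → Fin N) : Prop :=
  ∃ h : 0 < n, (∀ i : Fin n, i.val + 1 < n → x i = y i) ∧
    R.Adj (x ⟨n - 1, Nat.sub_lt h Nat.one_pos⟩) (y ⟨n - 1, Nat.sub_lt h Nat.one_pos⟩)

/-- Adjacency in `Ĝₙ`. -/
def hatAdj (G R : SimpleGraph (Fin N)) (V1 : Finset (Fin N)) {n : ℕ} (x y : Fin n → Fin N) :
    Prop :=
  GnEdge' G V1 x y ∨ REn R x y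

/-- The graph `Ĝₙ`. -/
def HatGn (G R : SimpleGraph (Fin N)) (V1 : Finset (Fin N)) (n : ℕ) :
    SimpleGraph (Fin n → Fin N) :=
  SimpleGraph.fromRel (hatAdj G R V1)

/-- Property R: every `x ∈ Σ₁` lies in a triangle having two edges in `E(G)` and
one extra edge (an edge of `R`). -/
def PropertyR (G R : SimpleGraph (Fin N)) : Prop :=
  ∀ x : Fin N, ∃ y z : Fin N,
    (G.Adj x y ∧ G.Adj x z ∧ R.Adj y z) ∨ (G.Adj x y ∧ R.Adj x z ∧ G.Adj y z) ∨
      (R.Adj x y ∧ G.Adj x z ∧ G.Adj y z)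

/-- Exactly two of the three edges of the triangle `(x,y,z)` are non-loop edges of `Gₙ`. -/
def exactlyTwoG (G : SimpleGraph (Fin N)) (V1 : Finset (Fin N)) {n : ℕ}
    (x y z : Fin n → Fin N) : Prop :=
  (GnEdge' G V1 x y ∧ GnEdge' G V1 x z ∧ ¬GnEdge' G V1 y z) ∨
    (GnEdge' G V1 x y ∧ ¬GnEdge' G V1 x z ∧ GnEdge' G V1 y z) ∨
      (¬GnEdge' G V1 x y ∧ GnEdge' G V1 x z ∧ GnEdge' G V1 y z)

/-- `Δₙ¹(x)` (counted over ordered pairs): class-1 regular triangles at `x` in `Ĝₙ`. -/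
def numTri1 (G R : SimpleGraph (Fin N)) (V1 : Finset (Fin N)) {n : ℕ} (x : Fin n → Fin N) :
    ℕ :=
  (univ.filter fun p : (Fin n → Fin N) × (Fin n → Fin N) =>
    GnEdge' G V1 x p.1 ∧ GnEdge' G V1 x p.2 ∧ REn R p.1 p.2).card

/-- `Δₙ²(x)` (counted over ordered pairs): class-2 regular triangles at `x` in `Ĝₙ`. -/
def numTri2 (G R : SimpleGraph (Fin N)) (V1 : Finset (Fin N)) {n : ℕ} (x : Fin n → Fin N) :
    ℕ :=
  (univ.filter fun p : (Fin n → Fin N) × (Fin n → Fin N) =>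
    GnEdge' G V1 x p.1 ∧ REn R x p.2 ∧ GnEdge' G V1 p.1 p.2).card

/-- `Δₙ^{ir}(x)` (counted over ordered pairs): irregular triangles at `x` in `Ĝₙ`. -/
def numTriIr (G R : SimpleGraph (Fin N)) (V1 : Finset (Fin N)) {n : ℕ} (x : Fin n → Fin N) :
    ℕ :=
  (univ.filter fun p : (Fin n → Fin N) × (Fin n → Fin N) =>
    hatAdj G R V1 x p.1 ∧ hatAdj G R V1 x p.2 ∧ hatAdj G R V1 p.1 p.2 ∧
      ¬exactlyTwoG G V1 x p.1 p.2).card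

/-- Exactly two of the three edges of the triangle `(x,y,z)` are edges of `G`. -/
def exactlyTwoB (G : SimpleGraph (Fin N)) (x y z : Fin N) : Prop :=
  (G.Adj x y ∧ G.Adj x z ∧ ¬G.Adj y z) ∨ (G.Adj x y ∧ ¬G.Adj x z ∧ G.Adj y z) ∨
    (¬G.Adj x y ∧ G.Adj x z ∧ G.Adj y z)

/-- `Δ¹(z)` (counted over ordered pairs): class-1 regular triangles at `z` in `Ĝ = G ⊔ R`. -/
def numTri1B (G R : SimpleGraph (Fin N)) (z : Fin N) : ℕ :=
  (univ.filter fun p : Fin N × Fin N => G.Adj z p.1 ∧ G.Adj z p.2 ∧ R.Adj p.1 p.2).card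

/-- `Δ²(z)` (counted over ordered pairs): class-2 regular triangles at `z` in `Ĝ = G ⊔ R`. -/
def numTri2B (G R : SimpleGraph (Fin N)) (z : Fin N) : ℕ :=
  (univ.filter fun p : Fin N × Fin N => G.Adj z p.1 ∧ R.Adj z p.2 ∧ G.Adj p.1 p.2).card

/-- `Δ^{ir}(z)` (counted over ordered pairs): irregular triangles at `z` in `Ĝ = G ⊔ R`. -/
def numTriIrB (G R : SimpleGraph (Fin N)) (z : Fin N) : ℕ :=
  (univ.filter fun p : Fin N × Fin N =>
    (G ⊔ R).Adj z p.1 ∧ (G ⊔ R).Adj z p.2 ∧ (G ⊔ R).Adj p.1 p.2 ∧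
      ¬exactlyTwoB G z p.1 p.2).card

/-- The number of ordered pairs of neighbors of `x` that are adjacent,
i.e. twice the number of triangles containing `x`. -/
def triOrd {α : Type*} [Fintype α] (H : SimpleGraph α) (x : α) : ℕ :=
  (univ.filter fun p : α × α => H.Adj x p.1 ∧ H.Adj x p.2 ∧ H.Adj p.1 p.2).card

/-- The local clustering coefficient
`C_x = #{edges between neighbors of x} / (deg x choose 2)`. -/
def clustering {α : Type*} [Fintype α] (H : SimpleGraph α) (x : α) : ℝ :=
  (triOrd H x : ℝ) / ((degH H x : ℝ) * ((degH H x : ℝ) - 1))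

/-- The degree of vertex `i` in the random graph `Gₙʳ` built from the digit variables `D`
(neighbors `j ≠ i` are counted). -/
def degR (G : SimpleGraph (Fin N)) (V1 : Finset (Fin N)) {n M : ℕ} {Ω : Type*}
    (D : Fin M → Fin n → Ω → Fin N) (i : Fin M) (ω : Ω) : ℕ :=
  (univ.filter fun j : Fin M => j ≠ i ∧
    EdgeRel G V1 (fun k => D i k ω) (fun k => D j k ω)).card

/-- `t_k = (d₁^{k+1} - 1)/(d₁ - 1) + 1`. -/
def tkD (d₁ k : ℕ) : ℝ := ((d₁ : ℝ) ^ (k + 1) - 1) / ((d₁ : ℝ) - 1) + 1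

theorem lt_prefixLen_iff {n : ℕ} (x y : Fin n → Fin N) (i : Fin n) :
    i.val < prefixLen x y ↔ ∀ j : Fin n, j ≤ i → x j = y j := by
  constructor
  · intro h
    by_contra hi
    have hsub : (univ.filter fun i : Fin n => ∀ j : Fin n, j ≤ i → x j = y j) ⊆ Finset.Iio i := by
      intro k hk
      simp only [Finset.mem_filter, Finset.mem_univ, true_and] at hk
      rw [Finset.mem_Iio]
      by_contra hik
      exact hi fun j hj => hk j (hj.trans (not_lt.mp hik))
    have hcard := Finset.card_le_card hsub
    rw [Fin.card_Iio] at hcard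
    unfold prefixLen at h
    omega
  · intro h
    have hsub : Finset.Iic i ⊆ (univ.filter fun i : Fin n => ∀ j : Fin n, j ≤ i → x j = y j) := by
      intro k hk
      rw [Finset.mem_Iic] at hk
      simp only [Finset.mem_filter, Finset.mem_univ, true_and]
      exact fun j hj => h j (hj.trans hk)
    have hcard := Finset.card_le_card hsub
    rw [Fin.card_Iic] at hcard
    unfold prefixLen
    omega

section Bipartite

variable {G : SimpleGraph (Fin N)} {V1 : Finset (Fin N)}

theorem edgeRel_of_adj_suffix (hbip : ∀ a b : Fin N, G.Adj a b → (a ∈ V1 ↔ b ∉ V1)) {n k : ℕ}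
    {x y : Fin n → Fin N} {t : Bool} (hx : postfixType V1 k x t)
    (hpre : ∀ i : Fin n, i.val < k → x i = y i)
    (hadj : ∀ i : Fin n, k ≤ i.val → G.Adj (x i) (y i)) : EdgeRel G V1 x y := by
  have hk : ∀ i : Fin n, prefixLen x y ≤ i.val → k ≤ i.val := by
    intro i hi
    by_contra hik
    exact absurd ((lt_prefixLen_iff x y i).2 fun j hj =>
      hpre j (lt_of_le_of_lt (Fin.le_def.1 hj) (not_le.mp hik))) (not_lt.mpr hi)
  refine Or.inr ⟨⟨t, fun i hi => hx i (hk i hi), fun i hi => ?_⟩, fun i hi => hadj i (hk i hi)⟩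
  have h₁ := hx i (hk i hi)
  have h₂ := hbip _ _ (hadj i (hk i hi))
  cases t <;> simp_all

theorem exists_walk_of_edgeRel {n : ℕ} {x y : Fin n → Fin N} (h : EdgeRel G V1 x y) :
    ∃ p : (GnSimple G V1 n).Walk x y, p.length ≤ 1 := by
  by_cases hxy : x = y
  · subst hxy
    exact ⟨SimpleGraph.Walk.nil, by simp⟩
  · have hadj : (GnSimple G V1 n).Adj x y := ⟨hxy, Or.inl h⟩
    exact ⟨hadj.toWalk, by simp⟩

theorem even_length_iff (hbip : ∀ a b : Fin N, G.Adj a b → (a ∈ V1 ↔ b ∉ V1)) {a b : Fin N}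
    (p : G.Walk a b) : Even p.length ↔ (a ∈ V1 ↔ b ∈ V1) := by
  induction p with
  | nil => simp
  | cons h p ih =>
    rw [SimpleGraph.Walk.length_cons, Nat.even_add_one, ih]
    have := hbip _ _ h
    tauto

theorem exists_walk_length_add_two_mul (hnb : ∀ a, ∃ b, G.Adj a b) {a b : Fin N}
    (p : G.Walk a b) (k : ℕ) : ∃ q : G.Walk a b, q.length = p.length + 2 * k := by
  induction k with
  | zero => exact ⟨p, by simp⟩
  | succ k ih =>
    obtain ⟨q, hq⟩ := ih
    obtain ⟨c, hc⟩ := hnb a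
    refine ⟨SimpleGraph.Walk.cons hc (SimpleGraph.Walk.cons hc.symm q), ?_⟩
    simp only [SimpleGraph.Walk.length_cons]
    omega

theorem exists_walk_length_eq (hbip : ∀ a b : Fin N, G.Adj a b → (a ∈ V1 ↔ b ∉ V1))
    (hconn : G.Connected) (hnb : ∀ a, ∃ b, G.Adj a b) {a b : Fin N} {L : ℕ}
    (hL : G.dist a b ≤ L) (hpar : Even L ↔ (a ∈ V1 ↔ b ∈ V1)) :
    ∃ q : G.Walk a b, q.length = L := by
  obtain ⟨p, hp⟩ := hconn.exists_walk_length_eq_dist a b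
  have hpe := even_length_iff hbip p
  have heven : Even (L - p.length) := by
    rw [Nat.even_sub (by omega), hpar, hpe]
  obtain ⟨k, hk⟩ := heven
  obtain ⟨q, hq⟩ := exists_walk_length_add_two_mul hnb p k
  exact ⟨q, by omega⟩

/-- Any word can be brought to constant type on its last `j + 1` letters in at most `j` steps. -/
theorem exists_walk_postfixType (hbip : ∀ a b : Fin N, G.Adj a b → (a ∈ V1 ↔ b ∉ V1))
    (hnb : ∀ a, ∃ b, G.Adj a b) {n : ℕ} (x : Fin n → Fin N) (j : ℕ) (hj : j < n) :
    ∃ (y : Fin n → Fin N) (t : Bool) (p : (GnSimple G V1 n).Walk x y),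
      postfixType V1 (n - 1 - j) y t ∧ p.length ≤ j := by
  induction j with
  | zero =>
    refine ⟨x, decide (x ⟨n - 1, by omega⟩ ∈ V1), SimpleGraph.Walk.nil, fun i hi => ?_, by simp⟩
    have : i = ⟨n - 1, by omega⟩ := Fin.ext (by simp only; omega)
    simp [this]
  | succ j ih =>
    obtain ⟨y, t, p, hy, hp⟩ := ih (by omega)
    let i₀ : Fin n := ⟨n - 1 - (j + 1), by omega⟩
    by_cases h : y i₀ ∈ V1 ↔ t = true
    · refine ⟨y, t, p, fun i hi => ?_, by omega⟩
      rcases eq_or_ne i i₀ with rfl | hne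
      · exact h
      · refine hy i ?_
        have : i.val ≠ n - 1 - (j + 1) := fun h' => hne (Fin.ext h')
        omega
    · choose nb hnb using hnb
      let z : Fin n → Fin N := fun i => if n - 1 - j ≤ i.val then nb (y i) else y i
      have hadj : ∀ i : Fin n, n - 1 - j ≤ i.val → G.Adj (y i) (z i) := by
        intro i hi
        simp only [z, if_pos hi]
        exact hnb _
      have hpre : ∀ i : Fin n, i.val < n - 1 - j → y i = z i := by
        intro i hi
        simp only [z, if_neg (not_le.mpr hi)]
      obtain ⟨q, hq⟩ := exists_walk_of_edgeRel (edgeRel_of_adj_suffix hbip hy hpre hadj)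
      refine ⟨z, !t, p.append q, fun i hi => ?_, ?_⟩
      · by_cases hi' : n - 1 - j ≤ i.val
        · have h₁ := hy i hi'
          have h₂ := hbip _ _ (hadj i hi')
          cases t <;> simp_all
        · have : i = i₀ := Fin.ext (by simp only [i₀]; omega)
          subst this
          rw [← hpre i₀ (not_le.mp hi')]
          cases t <;> simp_all
      · rw [SimpleGraph.Walk.length_append]
        omega

/-- Letterwise walks of a common length between words of constant type assemble to a walk
in `Gₙ`. -/
theorem exists_walk_of_letter_walks (hbip : ∀ a b : Fin N, G.Adj a b → (a ∈ V1 ↔ b ∉ V1))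
    {n : ℕ} (L : ℕ) (x y : Fin n → Fin N) (t : Bool) (hx : postfixType V1 0 x t)
    (h : ∀ i, ∃ q : G.Walk (x i) (y i), q.length = L) :
    ∃ p : (GnSimple G V1 n).Walk x y, p.length ≤ L := by
  induction L generalizing x t with
  | zero =>
    have hxy : x = y := funext fun i => by
      obtain ⟨q, hq⟩ := h i
      exact SimpleGraph.Walk.eq_of_length_eq_zero hq
    subst hxy
    exact ⟨SimpleGraph.Walk.nil, by simp⟩
  | succ L ih =>
    have hstep : ∀ i, ∃ c, G.Adj (x i) c ∧ ∃ q : G.Walk c (y i), q.length = L := by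
      intro i
      obtain ⟨q, hq⟩ := h i
      obtain ⟨c, hc, q', rfl⟩ := SimpleGraph.Walk.not_nil_iff.1
        (fun hnil => by have := SimpleGraph.Walk.length_eq_zero_iff.2 hnil; omega : ¬ q.Nil)
      exact ⟨c, hc, q', by simpa using hq⟩
    choose z hz hq using hstep
    have hzt : postfixType V1 0 z (!t) := by
      intro i hi
      have h₁ := hx i hi
      have h₂ := hbip _ _ (hz i)
      cases t <;> simp_all
    obtain ⟨p, hp⟩ := ih z (!t) hzt hq
    obtain ⟨r, hr⟩ := exists_walk_of_edgeRel
      (edgeRel_of_adj_suffix (k := 0) hbip hx (fun i hi => absurd hi (by omega)) fun i _ => hz i)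
    refine ⟨r.append p, ?_⟩
    rw [SimpleGraph.Walk.length_append]
    omega

theorem dist_le_fdiam {α : Type*} [Fintype α] (H : SimpleGraph α) (a b : α) :
    H.dist a b ≤ fdiam H :=
  Finset.le_sup (f := fun p : α × α => H.dist p.1 p.2) (Finset.mem_univ (a, b))

theorem exists_walk_constant_type (hbip : ∀ a b : Fin N, G.Adj a b → (a ∈ V1 ↔ b ∉ V1))
    (hconn : G.Connected) (hnb : ∀ a, ∃ b, G.Adj a b) {n : ℕ} (hn : 0 < n)
    {x y : Fin n → Fin N} {t s : Bool} (hx : postfixType V1 0 x t) (hy : postfixType V1 0 y s) :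
    ∃ p : (GnSimple G V1 n).Walk x y, p.length ≤ fdiam G := by
  have htype : ∀ i, (x i ∈ V1 ↔ y i ∈ V1) ↔ t = s := by
    intro i
    have h₁ := hx i (Nat.zero_le _)
    have h₂ := hy i (Nat.zero_le _)
    cases t <;> cases s <;> simp_all
  by_cases hpar : Even (fdiam G) ↔ t = s
  · exact exists_walk_of_letter_walks hbip _ x y t hx fun i =>
      exists_walk_length_eq hbip hconn hnb (dist_le_fdiam G _ _) (hpar.trans (htype i).symm)
  · have hlt : ∀ i, G.dist (x i) (y i) < fdiam G := by
      intro i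
      refine lt_of_le_of_ne (dist_le_fdiam G _ _) fun heq => hpar ?_
      obtain ⟨p, hp⟩ := hconn.exists_walk_length_eq_dist (x i) (y i)
      rw [← heq, ← hp, even_length_iff hbip p, htype i]
    have hpos : 1 ≤ fdiam G := (Nat.zero_le _).trans_lt (hlt ⟨0, hn⟩)
    have hpar' : Even (fdiam G - 1) ↔ t = s := by
      rw [Nat.even_sub hpos]
      have : ¬ Even 1 := by decide
      tauto
    obtain ⟨p, hp⟩ := exists_walk_of_letter_walks hbip (fdiam G - 1) x y t hx fun i =>
      exists_walk_length_eq hbip hconn hnb (Nat.le_sub_one_of_lt (hlt i))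
        (hpar'.trans (htype i).symm)
    exact ⟨p, by omega⟩

theorem exists_walk_length_le (hbip : ∀ a b : Fin N, G.Adj a b → (a ∈ V1 ↔ b ∉ V1))
    (hconn : G.Connected) (hnb : ∀ a, ∃ b, G.Adj a b) {n : ℕ} (hn : 0 < n)
    (x y : Fin n → Fin N) :
    ∃ p : (GnSimple G V1 n).Walk x y, p.length ≤ 2 * n + fdiam G - 2 := by
  obtain ⟨x', t, p, hx', hp⟩ := exists_walk_postfixType hbip hnb x (n - 1) (by omega)
  obtain ⟨y', s, q, hy', hq⟩ := exists_walk_postfixType hbip hnb y (n - 1) (by omega)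
  rw [Nat.sub_self] at hx' hy'
  obtain ⟨r, hr⟩ := exists_walk_constant_type hbip hconn hnb hn hx' hy'
  refine ⟨(p.append r).append q.reverse, ?_⟩
  simp only [SimpleGraph.Walk.length_append, SimpleGraph.Walk.length_reverse]
  omega

theorem EdgeRel.symm {n : ℕ} {x y : Fin n → Fin N} (h : EdgeRel G V1 x y) :
    EdgeRel G V1 y x := by
  have hcomm : prefixLen y x = prefixLen x y := by
    simp only [prefixLen, eq_comm]
  rcases h with h | ⟨⟨t, h₁, h₂⟩, h₃⟩
  · exact Or.inl h.symm
  · refine Or.inr ⟨⟨!t, ?_, ?_⟩, ?_⟩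
    · rwa [hcomm]
    · rwa [hcomm, Bool.not_not]
    · rw [hcomm]
      exact fun i hi => (h₃ i hi).symm

theorem blockCount_le_of_edgeRel {n : ℕ} {x y : Fin n → Fin N} (h : EdgeRel G V1 x y) :
    blockCount V1 0 x ≤ blockCount V1 0 y + 1 := by
  rcases h with rfl | ⟨⟨t, hx, -⟩, -⟩
  · omega
  unfold blockCount
  set A := univ.filter fun i : Fin n =>
    0 ≤ i.val ∧ ∃ h : i.val + 1 < n, ¬((x i ∈ V1) ↔ x ⟨i.val + 1, h⟩ ∈ V1) with hA
  set B := univ.filter fun i : Fin n =>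
    0 ≤ i.val ∧ ∃ h : i.val + 1 < n, ¬((y i ∈ V1) ↔ y ⟨i.val + 1, h⟩ ∈ V1) with hB
  have hAB : (A \ B).card ≤ 1 := by
    have key : ∀ i ∈ A \ B, i.val + 1 = prefixLen x y := by
      intro i hi
      simp only [hA, hB, Finset.mem_sdiff, Finset.mem_filter, Finset.mem_univ, true_and,
        Nat.zero_le] at hi
      obtain ⟨⟨hin, hne⟩, hiB⟩ := hi
      have hle : i.val < prefixLen x y := by
        by_contra hle
        exact hne ((hx i (by omega)).trans (hx ⟨i.val + 1, hin⟩ (by simp only; omega)).symm)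
      by_contra hlt
      have hpre := (lt_prefixLen_iff x y ⟨i.val + 1, hin⟩).1 (by simp only; omega)
      refine hiB ⟨hin, ?_⟩
      rwa [← hpre i (Fin.le_def.2 (by simp)), ← hpre _ le_rfl]
    rw [Finset.card_le_one]
    intro i hi j hj
    have h₁ := key i hi
    have h₂ := key j hj
    exact Fin.ext (by omega)
  have := Finset.card_le_card_sdiff_add_card (s := A) (t := B)
  omega

theorem blockCount_eq_one_of_first_ne {m : ℕ} {x y : Fin (m + 1) → Fin N}
    (h : EdgeRel G V1 x y) (h0 : x 0 ≠ y 0) : blockCount V1 0 x = 1 := by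
  have hk : prefixLen x y = 0 := by
    by_contra hk
    exact h0 ((lt_prefixLen_iff x y 0).1 (by simp only [Fin.val_zero]; omega) 0 le_rfl)
  rcases h with rfl | ⟨⟨t, hx, -⟩, -⟩
  · exact absurd rfl h0
  · rw [hk] at hx
    unfold blockCount
    rw [Finset.filter_eq_empty_iff.2]
    · simp
    · rintro i - ⟨-, hin, hne⟩
      exact hne ((hx i (Nat.zero_le _)).trans (hx _ (Nat.zero_le _)).symm)

theorem le_blockCount_of_alternating {m : ℕ} {x : Fin (m + 1) → Fin N}
    (h : ∀ i : Fin (m + 1), ∀ hi : i.val + 1 < m + 1, ¬(x i ∈ V1 ↔ x ⟨i.val + 1, hi⟩ ∈ V1)) :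
    m + 1 ≤ blockCount V1 0 x := by
  unfold blockCount
  have hcard := Finset.card_le_card_of_injOn (s := (univ : Finset (Fin m)))
    (t := univ.filter fun i : Fin (m + 1) =>
      0 ≤ i.val ∧ ∃ h : i.val + 1 < m + 1, ¬((x i ∈ V1) ↔ x ⟨i.val + 1, h⟩ ∈ V1))
    Fin.castSucc
    (fun i _ => by
      simp only [Finset.coe_filter, Set.mem_ofPred_eq, Finset.mem_univ, true_and, Nat.zero_le]
      have hi : (Fin.castSucc i).val + 1 < m + 1 := by simp
      exact ⟨hi, h _ hi⟩)
    ((Fin.castSucc_injective m).injOn)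
  rw [Finset.card_univ, Fintype.card_fin] at hcard
  omega

/-- Signed height of a word: words with first letter `a` sit at nonpositive height. It grows by
at most one along each edge of `Gₙ`. -/
def signedBlocks (V1 : Finset (Fin N)) (a : Fin N) {m : ℕ} (w : Fin (m + 1) → Fin N) : ℤ :=
  if w 0 = a then 1 - (blockCount V1 0 w : ℤ) else blockCount V1 0 w

theorem signedBlocks_le_of_edgeRel (a : Fin N) {m : ℕ} {x y : Fin (m + 1) → Fin N}
    (h : EdgeRel G V1 x y) : signedBlocks V1 a y ≤ signedBlocks V1 a x + 1 := by
  by_cases h0 : x 0 = y 0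
  · have h₁ := blockCount_le_of_edgeRel h
    have h₂ := blockCount_le_of_edgeRel h.symm
    unfold signedBlocks
    rw [h0]
    split_ifs <;> omega
  · have h₁ := blockCount_eq_one_of_first_ne h h0
    have h₂ := blockCount_eq_one_of_first_ne h.symm (Ne.symm h0)
    unfold signedBlocks
    rw [h₁, h₂]
    split_ifs <;> simp

theorem signedBlocks_le_of_walk (a : Fin N) {m : ℕ} {x y : Fin (m + 1) → Fin N}
    (p : (GnSimple G V1 (m + 1)).Walk x y) :
    signedBlocks V1 a y ≤ signedBlocks V1 a x + p.length := by
  induction p with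
  | nil => simp
  | cons h p ih =>
    have := signedBlocks_le_of_edgeRel a (h.2.elim id EdgeRel.symm)
    rw [SimpleGraph.Walk.length_cons]
    push_cast
    omega

theorem le_fdiam_GnSimple (hbip : ∀ a b : Fin N, G.Adj a b → (a ∈ V1 ↔ b ∉ V1))
    (hconn : G.Connected) (hnb : ∀ a, ∃ b, G.Adj a b) {a b : Fin N} (ha : a ∈ V1) (hb : b ∉ V1)
    {n : ℕ} (hn : 0 < n) : 2 * n ≤ fdiam (GnSimple G V1 n) + 1 := by
  obtain ⟨m, rfl⟩ : ∃ m, n = m + 1 := ⟨n - 1, by omega⟩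
  let x : Fin (m + 1) → Fin N := fun i => if Even i.val then a else b
  let y : Fin (m + 1) → Fin N := fun i => if Even i.val then b else a
  have hx : m + 1 ≤ blockCount V1 0 x := le_blockCount_of_alternating fun i hi => by
    by_cases h : Even i.val <;> simp [x, h, ha, hb, Nat.even_add_one]
  have hy : m + 1 ≤ blockCount V1 0 y := le_blockCount_of_alternating fun i hi => by
    by_cases h : Even i.val <;> simp [y, h, ha, hb, Nat.even_add_one]
  have hx0 : x 0 = a := by simp [x]
  have hy0 : y 0 ≠ a := by
    have : y 0 = b := by simp [y]
    rw [this]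
    rintro rfl
    exact hb ha
  obtain ⟨q, -⟩ := exists_walk_length_le hbip hconn hnb hn x y
  obtain ⟨p, hp⟩ := q.reachable.exists_walk_length_eq_dist
  have hpot := signedBlocks_le_of_walk a p
  unfold signedBlocks at hpot
  rw [if_pos hx0, if_neg hy0] at hpot
  have := dist_le_fdiam (GnSimple G V1 (m + 1)) x y
  omega

end Bipartite

/-- `Diam(Gₙ) ≤ 2n + Diam(G) - 2`, hence
`Diam(Gₙ) = (2/log N)·log(Nⁿ) + O(1)`. -/
theorem statement10 {N : ℕ} (G : SimpleGraph (Fin N)) (V1 : Finset (Fin N))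
    (hV1 : V1.Nonempty) (hV2 : V1ᶜ.Nonempty)
    (hbip : ∀ a b : Fin N, G.Adj a b → (a ∈ V1 ↔ b ∉ V1))
    (hE : G.edgeFinset.Nonempty) (hconn : G.Connected) :
    (∀ n : ℕ, 0 < n → fdiam (GnSimple G V1 n) ≤ 2 * n + fdiam G - 2) ∧
      ∃ C : ℝ, ∀ n : ℕ, 0 < n →
        |(fdiam (GnSimple G V1 n) : ℝ)
            - 2 / Real.log (N : ℝ) * Real.log ((N : ℝ) ^ n)| ≤ C := by
  obtain ⟨a, ha⟩ := hV1
  obtain ⟨b, hb⟩ := hV2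
  rw [Finset.mem_compl] at hb
  have hab : a ≠ b := fun h => hb (h ▸ ha)
  have : Nontrivial (Fin N) := ⟨a, b, hab⟩
  have hnb : ∀ c, ∃ d, G.Adj c d := fun c => hconn.preconnected.exists_adj_of_nontrivial c
  have hupper : ∀ n : ℕ, 0 < n → fdiam (GnSimple G V1 n) ≤ 2 * n + fdiam G - 2 := by
    intro n hn
    refine Finset.sup_le fun p _ => ?_
    obtain ⟨q, hq⟩ := exists_walk_length_le hbip hconn hnb hn p.1 p.2
    exact (SimpleGraph.dist_le q).trans hq
  refine ⟨hupper, fdiam G + 1, fun n hn => ?_⟩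
  have hN : 2 ≤ N := by
    have := Fintype.one_lt_card (α := Fin N)
    rw [Fintype.card_fin] at this
    exact this
  have hlog : Real.log (N : ℝ) ≠ 0 := (Real.log_pos (by exact_mod_cast hN)).ne'
  have hmain : 2 / Real.log (N : ℝ) * Real.log ((N : ℝ) ^ n) = 2 * n := by
    rw [Real.log_pow]
    field_simp
  have h₁ : (fdiam (GnSimple G V1 n) : ℝ) ≤ 2 * n + fdiam G := by
    have := hupper n hn
    exact_mod_cast (show fdiam (GnSimple G V1 n) ≤ 2 * n + fdiam G by omega)
  have h₂ : (2 * n : ℝ) ≤ fdiam (GnSimple G V1 n) + 1 := by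
    exact_mod_cast le_fdiam_GnSimple hbip hconn hnb ha hb hn
  have h₃ : (0 : ℝ) ≤ fdiam G := Nat.cast_nonneg _
  rw [hmain, abs_le]
  constructor <;> linarith

end HierGraph
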